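/- Let A and D be separable unital C*-algebras with D strongly self-absorbing. Then any two unital *-homomorphisms α, β : D → A ⊗ D are approximately unitarily equivalent. In particular, any two unital endomorphisms of D are approximately unitarily equivalent. -/

import Mathlib

open scoped MultiplierAlgebra TensorProduct
open Filter Topology

noncomputable section

universe u v w x

/-- Approximate unitary equivalence of two maps `φ ψ : A → B`, witnessed by a sequence of
unitaries in the multiplier algebra `𝓜(ℂ, B)` (in which `B` embeds canonically). -/
def ApproxUnitaryEquiv {A : Type u} {B : Type v} [NonUnitalCStarAlgebra B]
    (φ ψ : A → B) : Prop :=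
  ∃ v : ℕ → 𝓜(ℂ, B), (∀ n, v n ∈ unitary 𝓜(ℂ, B)) ∧
    ∀ a : A, Tendsto
      (fun n => ‖star (v n) * (φ a : 𝓜(ℂ, B)) * v n - (ψ a : 𝓜(ℂ, B))‖)
      atTop (𝓝 (0 : ℝ))

/-- Data exhibiting `T` as a C*-tensor product of `A` and `B`: a bilinear, multiplicative,
star-preserving, cross-normed map `A × B → T` with dense span. -/
structure CStarTensor (A : Type u) (B : Type v) (T : Type w) [NonUnitalCStarAlgebra A]
    [NonUnitalCStarAlgebra B] [NonUnitalCStarAlgebra T] where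
  tmul : A → B → T
  add_left : ∀ a a' b, tmul (a + a') b = tmul a b + tmul a' b
  add_right : ∀ a b b', tmul a (b + b') = tmul a b + tmul a b'
  smul_left : ∀ (c : ℂ) a b, tmul (c • a) b = c • tmul a b
  smul_right : ∀ (c : ℂ) a b, tmul a (c • b) = c • tmul a b
  mul_tmul : ∀ a a' b b', tmul a b * tmul a' b' = tmul (a * a') (b * b')
  star_tmul : ∀ a b, star (tmul a b) = tmul (star a) (star b)
  norm_tmul : ∀ a b, ‖tmul a b‖ = ‖a‖ * ‖b‖
  dense_span : Dense ((Submodule.span ℂ {t : T | ∃ a b, tmul a b = t} : Submodule ℂ T) : Set T)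

/-- Data exhibiting `T` as *the minimal (spatial) tensor product* of `A` and `B`: a C*-tensor
product which is dominated by every other C*-tensor product of `A` and `B` (i.e., it carries
the smallest C*-norm). -/
structure MinTensor (A : Type u) (B : Type v) (T : Type w) [NonUnitalCStarAlgebra A]
    [NonUnitalCStarAlgebra B] [NonUnitalCStarAlgebra T] extends CStarTensor A B T where
  minimal : ∀ (T' : Type (max u v)) [NonUnitalCStarAlgebra T'] (h : CStarTensor A B T'),
    ∃ π : T' →⋆ₙₐ[ℂ] T, ∀ a b, π (h.tmul a b) = tmul a b

/-- The first-factor unital embedding `d ↦ d ⊗ 1`. -/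
def MinTensor.fst {D : Type u} {E : Type v} {T : Type w} [CStarAlgebra D] [CStarAlgebra E]
    [CStarAlgebra T] (h : MinTensor D E T) : D → T := fun d => h.tmul d 1

/-- The second-factor unital embedding `d ↦ 1 ⊗ d`. -/
def MinTensor.snd {D : Type u} {E : Type v} {T : Type w} [CStarAlgebra D] [CStarAlgebra E]
    [CStarAlgebra T] (h : MinTensor D E T) : E → T := fun d => h.tmul 1 d

/-- A unital C*-algebra `D` has *approximately inner half flip* (with respect to a
realization `T` of the minimal tensor product `D ⊗ D`) if the two factor embeddings
`id_D ⊗ 1_D` and `1_D ⊗ id_D` of `D` into `D ⊗ D` are approximately unitarily equivalent. -/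
def HasApproxInnerHalfFlip {D : Type u} {T : Type w} [CStarAlgebra D] [CStarAlgebra T]
    (h : MinTensor D D T) : Prop :=
  ApproxUnitaryEquiv h.fst h.snd

/-- A unital C*-algebra `D` has *approximately inner flip* (with respect to a realization
`T` of `D ⊗ D`) if the flip automorphism `σ_D : a ⊗ b ↦ b ⊗ a` of `D ⊗ D` is approximately
unitarily equivalent to the identity map. -/
def HasApproxInnerFlip {D : Type u} {T : Type w} [CStarAlgebra D] [CStarAlgebra T]
    (h : MinTensor D D T) : Prop :=
  ∃ σ : T ≃⋆ₐ[ℂ] T, (∀ a b, σ (h.tmul a b) = h.tmul b a) ∧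
    ApproxUnitaryEquiv (⇑σ) (id : T → T)

/-- A unital C*-algebra `D ≇ ℂ` is *strongly self-absorbing* (with respect to a realization
`T` of the minimal tensor product `D ⊗ D`) if there is an isomorphism `φ : D → D ⊗ D` which
is approximately unitarily equivalent to `id_D ⊗ 1_D`. -/
def IsStronglySelfAbsorbing {D : Type u} {T : Type w} [CStarAlgebra D] [CStarAlgebra T]
    (h : MinTensor D D T) : Prop :=
  IsEmpty (D ≃⋆ₐ[ℂ] ℂ) ∧ ∃ φ : D ≃⋆ₐ[ℂ] T, ApproxUnitaryEquiv (⇑φ) h.fst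

section ApproxUnitary

/-- A local form of approximate unitary equivalence: on every finite set, up to every tolerance,
`φ` is conjugated to `ψ` by a unitary of the target algebra itself. -/
def FiniteApproxUnitaryEquiv {X : Type*} {B : Type*} [CStarAlgebra B] (φ ψ : X → B) : Prop :=
  ∀ (F : Finset X) (ε : ℝ), 0 < ε → ∃ u ∈ unitary B, ∀ a ∈ F, ‖star u * φ a * u - ψ a‖ < ε

theorem norm_unitary_conj {B : Type*} [CStarAlgebra B] {u : B} (hu : u ∈ unitary B) (b : B) :
    ‖star u * b * u‖ = ‖b‖ := by
  rw [CStarRing.norm_mul_mem_unitary _ hu,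
    CStarRing.norm_mem_unitary_mul _ (Unitary.star_mem hu)]

namespace FiniteApproxUnitaryEquiv

variable {X Y B C : Type*} [CStarAlgebra B] [CStarAlgebra C] {φ ψ χ : X → B}

theorem symm (h : FiniteApproxUnitaryEquiv φ ψ) : FiniteApproxUnitaryEquiv ψ φ := by
  intro F ε hε
  obtain ⟨u, hu, h⟩ := h F ε hε
  refine ⟨star u, Unitary.star_mem hu, fun a ha => ?_⟩
  have key : star (star u) * ψ a * star u - φ a
      = -(star (star u) * (star u * φ a * u - ψ a) * star u) := by
    have h1 : u * star u = 1 := Unitary.mul_star_self_of_mem hu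
    have h2 : u * (star u * φ a * u) * star u = φ a := by
      calc _ = (u * star u) * φ a * (u * star u) := by noncomm_ring
        _ = φ a := by rw [h1]; simp
    rw [star_star, mul_sub, sub_mul, h2]; abel
  rw [key, norm_neg, norm_unitary_conj (Unitary.star_mem hu)]
  exact h a ha

theorem trans (h₁ : FiniteApproxUnitaryEquiv φ ψ) (h₂ : FiniteApproxUnitaryEquiv ψ χ) :
    FiniteApproxUnitaryEquiv φ χ := by
  intro F ε hε
  obtain ⟨u, hu, h₁⟩ := h₁ F (ε / 2) (half_pos hε)
  obtain ⟨v, hv, h₂⟩ := h₂ F (ε / 2) (half_pos hε)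
  refine ⟨u * v, mul_mem hu hv, fun a ha => ?_⟩
  have key : star (u * v) * φ a * (u * v) - χ a
      = star v * (star u * φ a * u - ψ a) * v + (star v * ψ a * v - χ a) := by
    rw [star_mul]; noncomm_ring
  rw [key]
  refine (norm_add_le _ _).trans_lt ?_
  rw [norm_unitary_conj hv]
  linarith [h₁ a ha, h₂ a ha]

theorem comp_right (h : FiniteApproxUnitaryEquiv φ ψ) (f : Y → X) :
    FiniteApproxUnitaryEquiv (φ ∘ f) (ψ ∘ f) := by
  classical
  intro F ε hε
  obtain ⟨u, hu, h⟩ := h (F.image f) ε hε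
  exact ⟨u, hu, fun a ha => h _ (Finset.mem_image_of_mem f ha)⟩

theorem comp_left (h : FiniteApproxUnitaryEquiv φ ψ) (f : B →⋆ₐ[ℂ] C) :
    FiniteApproxUnitaryEquiv (f ∘ φ) (f ∘ ψ) := by
  intro F ε hε
  obtain ⟨u, hu, h⟩ := h F ε hε
  refine ⟨f u, Unitary.map_mem f hu, fun a ha => ?_⟩
  have key : star (f u) * f (φ a) * f u - f (ψ a) = f (star u * φ a * u - ψ a) := by
    simp [map_star]
  simp only [Function.comp_apply]
  rw [key]
  exact (NonUnitalStarAlgHom.norm_apply_le f _).trans_lt (h a ha)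

/-- For maps of separable domain which are equi-Lipschitz, the unitaries can be chosen as a
sequence. -/
theorem exists_seq {X : Type*} [SeminormedAddCommGroup X] [TopologicalSpace.SeparableSpace X]
    {φ ψ : X → B} (hφ : LipschitzWith 1 φ) (hψ : LipschitzWith 1 ψ)
    (h : FiniteApproxUnitaryEquiv φ ψ) :
    ∃ u : ℕ → B, (∀ n, u n ∈ unitary B) ∧
      ∀ a, Tendsto (fun n => star (u n) * φ a * u n) atTop (𝓝 (ψ a)) := by
  classical
  let d := TopologicalSpace.denseSeq X
  have h' : ∀ n : ℕ, ∃ u ∈ unitary B, ∀ a ∈ (Finset.range (n + 1)).image d,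
      ‖star u * φ a * u - ψ a‖ < 1 / ((n : ℝ) + 1) := fun n => h _ _ (by positivity)
  choose u hu hu' using h'
  refine ⟨u, hu, fun a => ?_⟩
  rw [Metric.tendsto_atTop]
  intro ε hε
  obtain ⟨k, hk⟩ := (TopologicalSpace.denseRange_denseSeq X).exists_dist_lt a
    (show 0 < ε / 4 by positivity)
  obtain ⟨N, hN⟩ := exists_nat_one_div_lt (show 0 < ε / 4 by positivity)
  refine ⟨max k N, fun n hn => ?_⟩
  have h1 := hu' n (d k) (Finset.mem_image_of_mem _ (by simp; omega))
  have h2 : 1 / ((n : ℝ) + 1) ≤ 1 / ((N : ℝ) + 1) := by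
    apply one_div_le_one_div_of_le (by positivity)
    have : (N : ℝ) ≤ n := by exact_mod_cast (le_max_right k N).trans hn
    linarith
  have h3 : ‖φ a - φ (d k)‖ ≤ dist a (d k) := by
    simpa [dist_eq_norm] using hφ.dist_le_mul a (d k)
  have h4 : ‖ψ (d k) - ψ a‖ ≤ dist a (d k) := by
    rw [norm_sub_rev]; simpa [dist_eq_norm] using hψ.dist_le_mul a (d k)
  have key : star (u n) * φ a * u n - ψ a = star (u n) * (φ a - φ (d k)) * u n
      + (star (u n) * φ (d k) * u n - ψ (d k)) + (ψ (d k) - ψ a) := by noncomm_ring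
  rw [dist_eq_norm, key]
  refine (norm_add₃_le).trans_lt ?_
  rw [norm_unitary_conj (hu n)]
  have : dist a (d k) < ε / 4 := hk
  linarith

end FiniteApproxUnitaryEquiv

section Multiplier

variable {B : Type*} [CStarAlgebra B]

theorem DoubleCentralizer.norm_coe_eq (b : B) : ‖(b : 𝓜(ℂ, B))‖ = ‖b‖ := by
  rw [← DoubleCentralizer.norm_fst, DoubleCentralizer.coe_fst]
  exact ContinuousLinearMap.opNorm_mul_apply ℂ B b

theorem DoubleCentralizer.eq_coe_fst_one (v : 𝓜(ℂ, B)) :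
    v = ((v.fst 1 : B) : 𝓜(ℂ, B)) := by
  have hs : ∀ x, v.snd x = x * v.fst 1 := fun x => by simpa using v.central x 1
  have hf : ∀ y, v.fst y = v.fst 1 * y := fun y => by
    have := v.central 1 y
    rw [one_mul] at this
    rw [← this, hs 1, one_mul]
  apply DoubleCentralizer.ext
  refine Prod.ext ?_ ?_ <;> ext x
  · exact hf x
  · exact hs x

theorem DoubleCentralizer.coe_one_eq : ((1 : B) : 𝓜(ℂ, B)) = 1 := by
  rw [DoubleCentralizer.eq_coe_fst_one (1 : 𝓜(ℂ, B))]
  simp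

theorem DoubleCentralizer.coe_mul_eq (a b : B) :
    ((a * b : B) : 𝓜(ℂ, B)) = (a : 𝓜(ℂ, B)) * (b : 𝓜(ℂ, B)) :=
  map_mul (DoubleCentralizer.coeHom (𝕜 := ℂ) (A := B)) a b

theorem DoubleCentralizer.coe_star_eq (a : B) :
    ((star a : B) : 𝓜(ℂ, B)) = star (a : 𝓜(ℂ, B)) :=
  map_star (DoubleCentralizer.coeHom (𝕜 := ℂ) (A := B)) a

theorem DoubleCentralizer.coe_sub_eq (a b : B) :
    ((a - b : B) : 𝓜(ℂ, B)) = (a : 𝓜(ℂ, B)) - (b : 𝓜(ℂ, B)) :=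
  map_sub (DoubleCentralizer.coeHom (𝕜 := ℂ) (A := B)) a b

theorem DoubleCentralizer.coe_mem_unitary_iff (b : B) :
    (b : 𝓜(ℂ, B)) ∈ unitary 𝓜(ℂ, B) ↔ b ∈ unitary B := by
  have inj : ∀ x y : B, (x : 𝓜(ℂ, B)) = y → x = y := fun x y h => by
    rw [← sub_eq_zero, ← norm_eq_zero, ← norm_coe_eq, coe_sub_eq, h]; simp
  constructor
  · rintro ⟨h1, h2⟩
    rw [← coe_star_eq, ← coe_mul_eq, ← coe_one_eq] at h1 h2
    exact ⟨inj _ _ h1, inj _ _ h2⟩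
  · rintro ⟨h1, h2⟩
    constructor
    · rw [← coe_star_eq, ← coe_mul_eq, h1, coe_one_eq]
    · rw [← coe_star_eq, ← coe_mul_eq, h2, coe_one_eq]

theorem approxUnitaryEquiv_iff {X : Type*} (φ ψ : X → B) :
    ApproxUnitaryEquiv φ ψ ↔ ∃ u : ℕ → B, (∀ n, u n ∈ unitary B) ∧
      ∀ a, Tendsto (fun n => star (u n) * φ a * u n) atTop (𝓝 (ψ a)) := by
  have key : ∀ (u : B) (x y : B), ‖star (u : 𝓜(ℂ, B)) * (x : 𝓜(ℂ, B)) * (u : 𝓜(ℂ, B)) -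
      (y : 𝓜(ℂ, B))‖ = ‖star u * x * u - y‖ := fun u x y => by
    rw [← DoubleCentralizer.norm_coe_eq (star u * x * u - y), DoubleCentralizer.coe_sub_eq,
      DoubleCentralizer.coe_mul_eq, DoubleCentralizer.coe_mul_eq, DoubleCentralizer.coe_star_eq]
  constructor
  · rintro ⟨v, hv, h⟩
    refine ⟨fun n => (v n).fst 1, fun n => ?_, fun a => ?_⟩
    · rw [← DoubleCentralizer.coe_mem_unitary_iff, ← DoubleCentralizer.eq_coe_fst_one]
      exact hv n
    · rw [tendsto_iff_norm_sub_tendsto_zero]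
      refine (h a).congr fun n => ?_
      rw [← key, ← DoubleCentralizer.eq_coe_fst_one]
  · rintro ⟨u, hu, h⟩
    refine ⟨fun n => (u n : 𝓜(ℂ, B)),
      fun n => (DoubleCentralizer.coe_mem_unitary_iff _).2 (hu n), fun a => ?_⟩
    simp only [key]
    exact tendsto_iff_norm_sub_tendsto_zero.1 (h a)

theorem ApproxUnitaryEquiv.finite {X : Type*} {φ ψ : X → B} (h : ApproxUnitaryEquiv φ ψ) :
    FiniteApproxUnitaryEquiv φ ψ := by
  obtain ⟨u, hu, h⟩ := (approxUnitaryEquiv_iff φ ψ).1 h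
  intro F ε hε
  have : ∀ᶠ n in atTop, ∀ a ∈ F, ‖star (u n) * φ a * u n - ψ a‖ < ε := by
    rw [Filter.eventually_all_finset]
    intro a _
    simpa [dist_eq_norm] using Metric.tendsto_nhds.1 (h a) ε hε
  obtain ⟨n, hn⟩ := this.exists
  exact ⟨u n, hu n, hn⟩

theorem StarAlgHom.lipschitz {C : Type*} [CStarAlgebra C] (φ : B →⋆ₐ[ℂ] C) :
    LipschitzWith 1 φ :=
  LipschitzWith.of_dist_le_mul fun x y => by
    simpa [dist_eq_norm, ← map_sub] using NonUnitalStarAlgHom.norm_apply_le φ (x - y)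

end Multiplier

end ApproxUnitary

section TensorAlgebra

namespace CStarTensor

section Basic

variable {A B T : Type*} [NonUnitalCStarAlgebra A] [NonUnitalCStarAlgebra B]
  [NonUnitalCStarAlgebra T] (h : CStarTensor A B T)

/-- Precomposing the first leg with an automorphism and keeping the second. -/
def twistLeft (θ : A ≃⋆ₐ[ℂ] A) : CStarTensor A B T where
  tmul a b := h.tmul (θ a) b
  add_left a a' b := by simp [h.add_left]
  add_right a b b' := h.add_right _ _ _
  smul_left c a b := by simp [h.smul_left]
  smul_right c a b := h.smul_right _ _ _
  mul_tmul a a' b b' := by simp [h.mul_tmul]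
  star_tmul a b := by rw [h.star_tmul, map_star]
  norm_tmul a b := by rw [h.norm_tmul, StarAlgEquiv.norm_map]
  dense_span := by
    convert h.dense_span using 3
    ext t
    constructor
    · rintro ⟨a, b, rfl⟩; exact ⟨_, b, rfl⟩
    · rintro ⟨a, b, rfl⟩; exact ⟨θ.symm a, b, by simp⟩

/-- Exchanging the two legs. -/
def swap : CStarTensor B A T where
  tmul b a := h.tmul a b
  add_left a a' b := h.add_right _ _ _
  add_right a b b' := h.add_left _ _ _
  smul_left c a b := h.smul_right _ _ _
  smul_right c a b := h.smul_left _ _ _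
  mul_tmul a a' b b' := h.mul_tmul _ _ _ _
  star_tmul a b := h.star_tmul _ _
  norm_tmul a b := by rw [h.norm_tmul, mul_comm]
  dense_span := by
    convert h.dense_span using 3
    ext t
    constructor
    · rintro ⟨a, b, rfl⟩; exact ⟨b, a, rfl⟩
    · rintro ⟨a, b, rfl⟩; exact ⟨b, a, rfl⟩

theorem induction_closed {p : T → Prop} (hp : IsClosed {t | p t})
    (htmul : ∀ a b, p (h.tmul a b)) (h0 : p 0) (hadd : ∀ s t, p s → p t → p (s + t))
    (hsmul : ∀ (c : ℂ) t, p t → p (c • t)) (t : T) : p t := by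
  refine h.dense_span.induction (fun x hx => ?_) hp t
  refine Submodule.span_induction ?_ h0 (fun x y _ _ => hadd x y) (fun c x _ => hsmul c x) hx
  rintro _ ⟨a, b, rfl⟩
  exact htmul a b

end Basic

section Unital

variable {A B T : Type*} [CStarAlgebra A] [CStarAlgebra B]
  [CStarAlgebra T] (h : CStarTensor A B T) (h1 : h.tmul 1 1 = 1)

/-- The first-factor embedding as a unital `*`-homomorphism. -/
def fstHom : A →⋆ₐ[ℂ] T where
  toFun a := h.tmul a 1
  map_one' := h1
  map_mul' a b := by rw [h.mul_tmul, mul_one]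
  map_zero' := by simpa using h.smul_left 0 0 1
  map_add' a b := h.add_left _ _ _
  commutes' r := by rw [Algebra.algebraMap_eq_smul_one, h.smul_left, h1,
    Algebra.algebraMap_eq_smul_one]
  map_star' a := by rw [h.star_tmul, star_one]

/-- The second-factor embedding as a unital `*`-homomorphism. -/
def sndHom : B →⋆ₐ[ℂ] T where
  toFun b := h.tmul 1 b
  map_one' := h1
  map_mul' a b := by rw [h.mul_tmul, mul_one]
  map_zero' := by simpa using h.smul_right 0 1 0
  map_add' a b := h.add_right _ _ _
  commutes' r := by rw [Algebra.algebraMap_eq_smul_one, h.smul_right, h1,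
    Algebra.algebraMap_eq_smul_one]
  map_star' a := by rw [h.star_tmul, star_one]

@[simp] theorem fstHom_apply (a : A) : h.fstHom h1 a = h.tmul a 1 := rfl

@[simp] theorem sndHom_apply (b : B) : h.sndHom h1 b = h.tmul 1 b := rfl

/-- The algebraic tensor product mapping to `T`. -/
def ofAlg : A ⊗[ℂ] B →ₐ[ℂ] T :=
  Algebra.TensorProduct.lift (h.fstHom h1 : A →ₐ[ℂ] T) (h.sndHom h1 : B →ₐ[ℂ] T) fun a b => by
    change h.tmul a 1 * h.tmul 1 b = h.tmul 1 b * h.tmul a 1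
    simp [h.mul_tmul]

@[simp] theorem ofAlg_tmul (a : A) (b : B) : h.ofAlg h1 (a ⊗ₜ b) = h.tmul a b := by
  simp [ofAlg, h.mul_tmul]

theorem ofAlg_star (x : A ⊗[ℂ] B) : h.ofAlg h1 (star x) = star (h.ofAlg h1 x) := by
  induction x with
  | zero => simp
  | tmul a b => simp [h.star_tmul]
  | add x y hx hy => simp [hx, hy]

theorem denseRange_ofAlg : DenseRange (h.ofAlg h1) := by
  refine h.dense_span.mono fun t ht => ?_
  have : Submodule.span ℂ {t : T | ∃ a b, h.tmul a b = t} ≤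
      LinearMap.range (h.ofAlg h1).toLinearMap := by
    rw [Submodule.span_le]
    rintro _ ⟨a, b, rfl⟩
    exact ⟨a ⊗ₜ b, by simp⟩
  exact this ht

end Unital

end CStarTensor

section HalfFlip

variable {D : Type u} {T : Type u} [CStarAlgebra D] [CStarAlgebra T] (h : MinTensor D D T)

theorem MinTensor.exists_twistLeft (h1 : h.tmul 1 1 = 1) (θ : D ≃⋆ₐ[ℂ] D) :
    ∃ Θ : T →⋆ₐ[ℂ] T, ∀ a b, Θ (h.tmul a b) = h.tmul (θ a) b := by
  obtain ⟨π, hπ⟩ := h.minimal T (h.toCStarTensor.twistLeft θ.symm)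
  have hπ' : ∀ a b, π (h.tmul a b) = h.tmul (θ a) b := fun a b => by
    simpa [CStarTensor.twistLeft] using hπ (θ a) b
  have hone : π 1 = 1 := by rw [← h1, hπ', map_one]
  exact ⟨{ π with
    map_one' := hone
    commutes' := fun r => by
      change π _ = _
      rw [Algebra.algebraMap_eq_smul_one, map_smul, hone] }, hπ'⟩

theorem MinTensor.exists_flip :
    ∃ σ : T ≃⋆ₐ[ℂ] T, ∀ a b, σ (h.tmul a b) = h.tmul b a := by
  obtain ⟨π, hπ⟩ := h.minimal T h.toCStarTensor.swap
  have hπ' : ∀ a b, π (h.tmul a b) = h.tmul b a := fun a b => hπ b a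
  have hc : Continuous π := AddMonoidHomClass.continuous_of_bound π 1
    (by simpa using NonUnitalStarAlgHom.norm_apply_le π)
  have inv : ∀ t, π (π t) = t := by
    refine h.toCStarTensor.induction_closed (isClosed_eq (hc.comp hc) continuous_id)
      ?_ ?_ ?_ ?_
    · intro a b; rw [hπ', hπ']
    · simp
    · intro s t hs ht; simp [hs, ht]
    · intro c t ht; simp [ht]
  exact ⟨{ π with
    invFun := π
    left_inv := inv
    right_inv := inv
    map_smul' := fun c x => map_smul π c x }, hπ'⟩

/-- A strongly self-absorbing algebra has approximately inner half flip. -/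
theorem halfFlip_of_iso (h1 : h.tmul 1 1 = 1) (φ : D ≃⋆ₐ[ℂ] T)
    (hφ : FiniteApproxUnitaryEquiv φ h.fst) :
    FiniteApproxUnitaryEquiv h.fst h.snd := by
  obtain ⟨σ, hσ⟩ := h.exists_flip
  obtain ⟨Θ, hΘ⟩ := h.exists_twistLeft h1 ((φ.trans σ).trans φ.symm)
  have key : ∀ d, φ (φ.symm d) = d := fun d => by simp
  have e1 : FiniteApproxUnitaryEquiv h.snd (fun d => h.fst (φ.symm (h.snd d))) := by
    have := hφ.comp_right (fun d => φ.symm (h.snd d))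
    simpa [Function.comp_def] using this
  have e2 := e1.comp_left Θ
  have e3 : (Θ ∘ fun d => h.fst (φ.symm (h.snd d))) = fun d => h.fst (φ.symm (h.fst d)) := by
    ext d
    simp [MinTensor.fst, MinTensor.snd, hΘ, hσ]
  have e4 : Θ ∘ h.snd = h.snd := by
    ext d
    simp [MinTensor.snd, hΘ]
  rw [e3, e4] at e2
  have e5 : FiniteApproxUnitaryEquiv h.fst (fun d => h.fst (φ.symm (h.fst d))) := by
    have := (hφ.comp_left (φ.symm : T →⋆ₐ[ℂ] D)).comp_left (h.toCStarTensor.fstHom h1)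
    simp only [Function.comp_def, StarAlgHom.coe_coe, StarAlgEquiv.symm_apply_apply] at this
    exact this
  exact e5.trans e2.symm

end HalfFlip

end TensorAlgebra

section Simplicity

theorem exists_approxUnit_of_ker {D E : Type*} [CStarAlgebra D] [PartialOrder D]
    [StarOrderedRing D] [CStarAlgebra E] (π : D →⋆ₐ[ℂ] E) {k : D} (hk : 0 ≤ k) (hπ : π k = 0)
    {δ : ℝ} (hδ : 0 < δ) :
    ∃ z : D, star z = z ∧ ‖z‖ ≤ 1 ∧ π z = 1 ∧ ‖z * k * z‖ ≤ δ := by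
  have hsa : IsSelfAdjoint k := hk.isSelfAdjoint
  let f : ℝ → ℝ := fun t => δ / (δ + |t|)
  have hpos : ∀ t, 0 < δ + |t| := fun t => by positivity
  have hf : Continuous f := by
    refine continuous_const.div (by fun_prop) fun t => (hpos t).ne'
  have hπc : Continuous (π.restrictScalars ℝ) := (StarAlgHom.lipschitz π).continuous
  refine ⟨cfc f k, (cfc_predicate f k).star_eq, ?_, ?_, ?_⟩
  · refine norm_cfc_le zero_le_one fun t _ => ?_
    rw [Real.norm_eq_abs, abs_of_nonneg (by positivity), div_le_one (hpos t)]
    linarith [abs_nonneg t]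
  · have := (π.restrictScalars ℝ).map_cfc f k hf.continuousOn hπc hsa
      (by change IsSelfAdjoint (π k); rw [hπ]; exact IsSelfAdjoint.zero _)
    change π _ = cfc f (π k) at this
    rw [this, hπ, cfc_apply_zero]
    simp [f, hδ.ne']
  · have h1 : cfc f k * k * cfc f k = cfc (fun t => f t * t * f t) k := by
      rw [cfc_mul (fun t => f t * t) f k (by fun_prop) (by fun_prop),
        cfc_mul f (fun t => t) k (by fun_prop) (by fun_prop), cfc_id' ℝ k]
    rw [h1]
    refine norm_cfc_le hδ.le fun t _ => ?_
    have h2 : f t ≤ 1 := by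
      rw [div_le_one (hpos t)]; linarith [abs_nonneg t]
    have h3 : 0 ≤ f t := by positivity
    have h4 : f t * |t| ≤ δ := by
      simp only [f]
      rw [div_mul_eq_mul_div, div_le_iff₀ (hpos t)]
      nlinarith [abs_nonneg t]
    rw [norm_mul, norm_mul, Real.norm_eq_abs, Real.norm_eq_abs, abs_of_nonneg h3]
    nlinarith [abs_nonneg t]

/-- A unital C*-algebra with approximately inner half flip is simple: all its nonzero unital
representations are faithful. -/
theorem injective_of_halfFlip {D T E : Type*} [CStarAlgebra D] [CStarAlgebra T]
    [CStarAlgebra E] [Nontrivial E] (h : CStarTensor D D T) (h1 : h.tmul 1 1 = 1)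
    (hff : FiniteApproxUnitaryEquiv (h.fstHom h1) (h.sndHom h1)) (π : D →⋆ₐ[ℂ] E) :
    Function.Injective π := by
  let _ := CStarAlgebra.spectralOrder D
  have _ := CStarAlgebra.spectralOrderedRing D
  rw [injective_iff_map_eq_zero]
  intro d hd
  by_contra hd0
  have hdpos : 0 < ‖d‖ := norm_pos_iff.2 hd0
  set ε : ℝ := ‖d‖ / 4 with hε
  have hεpos : 0 < ε := by positivity
  obtain ⟨u, hu, hud⟩ := hff.symm {d} ε hεpos
  replace hud := hud d (Finset.mem_singleton_self d)
  obtain ⟨x, hx⟩ := (h.denseRange_ofAlg h1).exists_dist_lt u (show 0 < 1 / 4 by norm_num)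
  rw [dist_eq_norm] at hx
  obtain ⟨S, hS⟩ := TensorProduct.exists_finset x
  set k : D := ∑ i ∈ S, star (d * i.2) * (d * i.2) with hk
  set M : ℝ := ∑ i ∈ S, ‖i.1‖ with hM
  have hM0 : 0 ≤ M := Finset.sum_nonneg fun i _ => norm_nonneg _
  obtain ⟨z, hzs, hz1, hπz, hzk⟩ := exists_approxUnit_of_ker π (k := k)
    (Finset.sum_nonneg fun i _ => star_mul_self_nonneg _)
    (by simp [hk, hd]) (δ := (ε / (M + 1)) ^ 2) (by positivity)
  have hz1' : 1 ≤ ‖z‖ := by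
    have := NonUnitalStarAlgHom.norm_apply_le π z
    rwa [hπz, norm_one] at this
  have hdz : ∀ i ∈ S, ‖d * i.2 * z‖ ≤ ε / (M + 1) := by
    intro i hi
    have : ‖d * i.2 * z‖ ^ 2 ≤ (ε / (M + 1)) ^ 2 := by
      rw [sq, ← CStarRing.norm_star_mul_self]
      refine le_trans ?_ hzk
      refine CStarAlgebra.norm_le_norm_of_nonneg_of_le (star_mul_self_nonneg _) ?_
      have e1 : star (d * i.2 * z) * (d * i.2 * z)
          = star z * (star (d * i.2) * (d * i.2)) * z := by
        simp only [star_mul]; noncomm_ring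
      have e2 : z * k * z = star z * k * z := by rw [hzs]
      rw [e1, e2]
      refine star_left_conjugate_le_conjugate ?_ z
      exact Finset.single_le_sum (f := fun i : D × D => star (d * i.2) * (d * i.2))
        (fun i _ => star_mul_self_nonneg _) hi
    exact le_of_sq_le_sq this (by positivity)
  have hxz : ‖h.tmul 1 d * h.ofAlg h1 x * h.tmul 1 z‖ ≤ ε := by
    have : h.tmul 1 d * h.ofAlg h1 x * h.tmul 1 z = ∑ i ∈ S, h.tmul i.1 (d * i.2 * z) := by
      simp [hS, Finset.mul_sum, Finset.sum_mul, h.mul_tmul]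
    rw [this]
    calc _ ≤ ∑ i ∈ S, ‖i.1‖ * (ε / (M + 1)) := by
          refine norm_sum_le_of_le _ fun i hi => ?_
          rw [h.norm_tmul]
          gcongr
          exact hdz i hi
      _ = M * (ε / (M + 1)) := by rw [← Finset.sum_mul]
      _ ≤ ε := by
        rw [← mul_div_assoc, div_le_iff₀ (by positivity)]
        nlinarith
  have hone : ‖(1 : D)‖ ≤ 1 := by
    have : Nontrivial D := ⟨⟨d, 0, hd0⟩⟩
    simp
  have n1 : ‖h.tmul 1 z‖ ≤ 1 := by
    rw [h.norm_tmul]; nlinarith [norm_nonneg (1 : D), norm_nonneg z]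
  have n2 : ‖h.tmul 1 d‖ ≤ ‖d‖ := by
    rw [h.norm_tmul]; nlinarith [norm_nonneg (1 : D), norm_nonneg d]
  have main : h.tmul d z = -((star u * h.tmul 1 d * u - h.tmul d 1) * h.tmul 1 z)
      + star u * (h.tmul 1 d * (u - h.ofAlg h1 x) * h.tmul 1 z)
      + star u * (h.tmul 1 d * h.ofAlg h1 x * h.tmul 1 z) := by
    have : h.tmul d z = h.tmul d 1 * h.tmul 1 z := by simp [h.mul_tmul]
    rw [this]; noncomm_ring
  have b1 : ‖-((star u * h.tmul 1 d * u - h.tmul d 1) * h.tmul 1 z)‖ ≤ ε := by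
    rw [norm_neg]
    refine (norm_mul_le _ _).trans ?_
    have : ‖star u * h.tmul 1 d * u - h.tmul d 1‖ ≤ ε := hud.le
    nlinarith [norm_nonneg (h.tmul 1 z)]
  have b2 : ‖star u * (h.tmul 1 d * (u - h.ofAlg h1 x) * h.tmul 1 z)‖ ≤ ε := by
    rw [CStarRing.norm_mem_unitary_mul _ (Unitary.star_mem hu)]
    calc _ ≤ ‖h.tmul 1 d‖ * ‖u - h.ofAlg h1 x‖ * ‖h.tmul 1 z‖ :=
          (norm_mul_le _ _).trans (by gcongr; exact norm_mul_le _ _)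
      _ ≤ ‖d‖ * (1 / 4) * 1 := by gcongr
      _ = ε := by rw [hε]; ring
  have b3 : ‖star u * (h.tmul 1 d * h.ofAlg h1 x * h.tmul 1 z)‖ ≤ ε := by
    rw [CStarRing.norm_mem_unitary_mul _ (Unitary.star_mem hu)]
    exact hxz
  have : ‖h.tmul d z‖ ≤ ε + ε + ε := by
    rw [main]
    exact norm_add₃_le.trans (by gcongr)
  rw [h.norm_tmul] at this
  nlinarith

end Simplicity

section States

open scoped ComplexOrder

variable {T : Type*} [CStarAlgebra T] [PartialOrder T] [StarOrderedRing T]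

theorem exists_state (T : Type*) [CStarAlgebra T] [PartialOrder T] [StarOrderedRing T]
    [Nontrivial T] : ∃ F : T →ₚ[ℂ] ℂ, F 1 = 1 := by
  obtain ⟨F, hF, hF1⟩ := exists_dual_vector'' ℂ (1 : T)
  rw [norm_one, RCLike.ofReal_one] at hF1
  have hle : ∀ x, ‖F x‖ ≤ ‖x‖ := fun x => F.le_of_opNorm_le hF x |>.trans (by simp)
  have him : ∀ x : T, IsSelfAdjoint x → (F x).im = 0 := by
    intro x hx
    have key : ∀ t : ℝ, ((F x).im + t) ^ 2 ≤ ‖x‖ ^ 2 + t ^ 2 := by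
      intro t
      set y : T := x + (t * Complex.I) • 1 with hy
      have h1 : F y = F x + t * Complex.I := by simp [hy, hF1]
      have h2 : star y * y = x * x + ((t : ℂ) ^ 2) • 1 := by
        have : star y = x - (t * Complex.I) • 1 := by
          simp [hy, hx.star_eq, sub_eq_add_neg]
        rw [this, hy]
        simp only [mul_add, sub_mul, smul_mul_assoc, one_mul, mul_smul_comm, mul_one,
          smul_sub, smul_smul]
        have : (t * Complex.I * (t * Complex.I) : ℂ) = -(t : ℂ) ^ 2 := by
          linear_combination ((t : ℂ) ^ 2) * Complex.I_sq
        rw [this, neg_smul]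
        abel
      have h3 : ‖y‖ ^ 2 ≤ ‖x‖ ^ 2 + t ^ 2 := by
        rw [sq, ← CStarRing.norm_star_mul_self, h2]
        refine (norm_add_le _ _).trans ?_
        gcongr
        · rw [sq]; exact norm_mul_le _ _
        · simp [norm_smul]
      have h4 : ((F x).im + t) ^ 2 ≤ ‖F y‖ ^ 2 := by
        rw [← Complex.normSq_eq_norm_sq, Complex.normSq_apply, h1]
        simp
        nlinarith [sq_nonneg (F x).re]
      refine h4.trans (le_trans ?_ h3)
      gcongr
      exact hle y
    by_contra h0
    have := key (‖x‖ ^ 2 / (F x).im)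
    have e : ((F x).im + ‖x‖ ^ 2 / (F x).im) ^ 2
        = (F x).im ^ 2 + 2 * ‖x‖ ^ 2 + (‖x‖ ^ 2 / (F x).im) ^ 2 := by
      field_simp
      ring
    rw [e] at this
    have h5 : 0 < (F x).im ^ 2 := by positivity
    nlinarith [sq_nonneg ‖x‖]
  refine ⟨PositiveLinearMap.mk₀ F.toLinearMap fun x hx => ?_, hF1⟩
  change 0 ≤ F x
  rw [Complex.nonneg_iff]
  refine ⟨?_, (him x hx.isSelfAdjoint).symm⟩
  have h6 : ‖algebraMap ℝ T ‖x‖ - x‖ ≤ ‖x‖ := by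
    have hub := hx.isSelfAdjoint.le_algebraMap_norm_self
    have := CStarAlgebra.norm_le_norm_of_nonneg_of_le (sub_nonneg.2 hub)
      (sub_le_self (algebraMap ℝ T ‖x‖) hx)
    simpa [norm_algebraMap'] using this
  have h7 : F (algebraMap ℝ T ‖x‖ - x) = ‖x‖ - F x := by
    rw [map_sub, Algebra.algebraMap_eq_smul_one, ← Complex.coe_smul, map_smul, hF1]
    simp
  have h8 := ((Complex.abs_re_le_norm _).trans (hle _)).trans h6
  rw [h7] at h8
  have := (abs_le.1 h8).2
  simp at this
  exact this

/-- States on `T`, regarded as a set of functions. -/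
def stateSet (T : Type*) [CStarAlgebra T] : Set (T → ℂ) :=
  {F | (∀ x y, F (x + y) = F x + F y) ∧ (∀ (c : ℂ) x, F (c • x) = c * F x) ∧
    (∀ x, 0 ≤ F (star x * x)) ∧ F 1 = 1}

theorem PositiveLinearMap.mem_stateSet (F : T →ₚ[ℂ] ℂ) (hF : F 1 = 1) :
    (F : T → ℂ) ∈ stateSet T :=
  ⟨map_add F, fun c x => by simp, fun x => F.map_nonneg (star_mul_self_nonneg x), hF⟩

theorem exists_positiveLinearMap_of_mem_stateSet {F : T → ℂ} (hF : F ∈ stateSet T) :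
    ∃ G : T →ₚ[ℂ] ℂ, (G : T → ℂ) = F := by
  refine ⟨PositiveLinearMap.mk₀ ⟨⟨F, hF.1⟩, hF.2.1⟩ fun x hx => ?_, rfl⟩
  obtain ⟨y, rfl⟩ := CStarAlgebra.nonneg_iff_eq_star_mul_self.1 hx
  exact hF.2.2.1 y

theorem isCompact_stateSet {T : Type*} [CStarAlgebra T] : IsCompact (stateSet T) := by
  let _ := CStarAlgebra.spectralOrder T
  have _ := CStarAlgebra.spectralOrderedRing T
  refine IsCompact.of_isClosed_subset
    (isCompact_univ_pi fun x : T => isCompact_closedBall (0 : ℂ) (4 * ‖x‖)) ?_ ?_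
  · simp only [stateSet, Set.ofPred_and, Set.ofPred_forall]
    refine ((isClosed_iInter fun x => isClosed_iInter fun y => ?_).inter
      ((isClosed_iInter fun c => isClosed_iInter fun x => ?_).inter
      ((isClosed_iInter fun x => ?_).inter ?_)))
    · exact isClosed_eq (by fun_prop) (by fun_prop)
    · exact isClosed_eq (by fun_prop) (by fun_prop)
    · exact isClosed_le continuous_const (by fun_prop)
    · exact isClosed_eq (by fun_prop) (by fun_prop)
  · intro F hF x _
    obtain ⟨G, rfl⟩ := exists_positiveLinearMap_of_mem_stateSet hF
    rw [mem_closedBall_zero_iff]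
    obtain ⟨y, hy, hyn, hyx⟩ := CStarAlgebra.exists_sum_four_nonneg x
    conv_lhs => rw [hyx]
    simp only [map_sum, map_smul]
    calc _ ≤ ∑ i : Fin 4, ‖x‖ := by
          refine norm_sum_le_of_le _ fun i _ => ?_
          rw [norm_smul, norm_pow, Complex.norm_I, one_pow, one_mul]
          have := G.norm_apply_le_of_nonneg (y i) (hy i)
          rw [hF.2.2.2, norm_one, one_mul] at this
          exact this.trans (hyn i)
      _ = 4 * ‖x‖ := by simp

end States

section ProductState

open scoped ComplexOrder

variable {T A B : Type*} [CStarAlgebra T] [PartialOrder T] [StarOrderedRing T]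
  [CStarAlgebra A] [CStarAlgebra B]

/-- If `F` restricts to an extreme point among the restrictions of states along `i`, then `F` is
multiplicative across `i` and any element of the form `c* c` commuting with the range of `i`. -/
theorem apply_mul_of_mem_extremePoints (i : A →⋆ₐ[ℂ] T) (F : T →ₚ[ℂ] ℂ) (hF1 : F 1 = 1)
    (hF : (fun a => F (i a)) ∈ ((fun (G : T → ℂ) a => G (i a)) '' stateSet T).extremePoints ℝ)
    (c c' : T) (hc : ∀ a, Commute (i a) c) (hc' : ∀ a, Commute (i a) c')
    (hcc : star c * c + star c' * c' = 1) {p : ℝ} (hp0 : 0 < p) (hp1 : p < 1)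
    (hp : F (star c * c) = p) (a : A) :
    F (i a * (star c * c)) = F (i a) * F (star c * c) := by
  have hmem : ∀ (q : ℝ) (d : T), 0 < q → F (star d * d) = q →
      (fun a => (F (star d * i a * d) / (q : ℂ))) ∈
        (fun (G : T → ℂ) a => G (i a)) '' stateSet T := by
    intro q d hq hd
    refine ⟨fun x => F (star d * x * d) / q, ⟨fun x y => ?_, fun k x => ?_, fun x => ?_, ?_⟩, rfl⟩ <;>
      beta_reduce
    · rw [mul_add, add_mul, map_add, add_div]
    · rw [mul_smul_comm, smul_mul_assoc, map_smul, smul_eq_mul, mul_div_assoc]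
    · have : star d * (star x * x) * d = star (x * d) * (x * d) := by
        rw [star_mul]; noncomm_ring
      rw [this]
      refine mul_nonneg (F.map_nonneg (star_mul_self_nonneg _)) ?_
      rw [inv_nonneg]
      exact_mod_cast hq.le
    · rw [mul_one, hd, div_self]
      exact_mod_cast hq.ne'
  have hp' : F (star c' * c') = ((1 - p : ℝ) : ℂ) := by
    have := congrArg F hcc
    rw [map_add, hF1, hp] at this
    push_cast
    linear_combination this
  have hconj : ∀ d : T, (∀ a, Commute (i a) d) → ∀ a, star d * i a * d = i a * (star d * d) := by
    intro d hd a
    have h2 : Commute (i a) (star d) := by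
      have := (hd (star a)).star_star
      rwa [map_star, star_star] at this
    rw [← h2.eq, mul_assoc]
  have hp0' : (p : ℂ) ≠ 0 := by exact_mod_cast hp0.ne'
  have hq0' : ((1 - p : ℝ) : ℂ) ≠ 0 := by exact_mod_cast (sub_pos.2 hp1).ne'
  have := ((mem_extremePoints_iff_left.1 hF).2 _ (hmem p c hp0 hp) _
    (hmem (1 - p) c' (sub_pos.2 hp1) hp')
    ⟨p, 1 - p, hp0, sub_pos.2 hp1, by ring, ?_⟩)
  · have h3 := congrFun this a
    beta_reduce at h3
    rw [hconj c hc, div_eq_iff hp0'] at h3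
    rw [h3, hp]
  · ext a
    simp only [Pi.add_apply, Pi.smul_apply, Complex.real_smul]
    rw [mul_div_cancel₀ _ hp0', mul_div_cancel₀ _ hq0', hconj c hc, hconj c' hc', ← map_add,
      ← mul_add, hcc, mul_one]

/-- Two commuting copies of unital C*-algebras admit a state which is multiplicative
across them. -/
theorem exists_product_state [Nontrivial T] (i : A →⋆ₐ[ℂ] T) (j : B →⋆ₐ[ℂ] T)
    (hij : ∀ a b, Commute (i a) (j b)) :
    ∃ F : T →ₚ[ℂ] ℂ, F 1 = 1 ∧ ∀ a b, F (i a * j b) = F (i a) * F (j b) := by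
  let _ := CStarAlgebra.spectralOrder B
  have _ := CStarAlgebra.spectralOrderedRing B
  have hcomp : IsCompact ((fun (G : T → ℂ) a => G (i a)) '' stateSet T) :=
    isCompact_stateSet.image (by fun_prop)
  obtain ⟨F₀, hF₀⟩ := exists_state T
  obtain ⟨f, hf⟩ := hcomp.extremePoints_nonempty ⟨_, _, F₀.mem_stateSet hF₀, rfl⟩
  obtain ⟨G, hG, rfl⟩ := hf.1
  obtain ⟨F, rfl⟩ := exists_positiveLinearMap_of_mem_stateSet hG
  have hF1 : F 1 = 1 := hG.2.2.2
  refine ⟨F, hF1, fun a b => ?_⟩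
  have hpos : ∀ b : B, 0 ≤ b → F (i a * j b) = F (i a) * F (j b) := by
    intro b hb
    set N : ℝ := ‖b‖ + 1 with hN
    have hN0 : 0 < N := by positivity
    set r : ℝ := (3 * N)⁻¹ with hr
    have hr0 : 0 < r := by positivity
    set e : B := (1 / 3 : ℝ) • 1 + r • b with he
    have hrb : r • b ≤ (1 / 3 : ℝ) • (1 : B) := by
      have h1 := hb.isSelfAdjoint.le_algebraMap_norm_self
      have h2 : algebraMap ℝ B ‖b‖ ≤ algebraMap ℝ B N := algebraMap_mono _ (by linarith)
      have h3 := smul_le_smul_of_nonneg_left (h1.trans h2) hr0.le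
      rwa [Algebra.algebraMap_eq_smul_one, smul_smul,
        show r * N = 1 / 3 by rw [hr]; field_simp] at h3
    have hrb0 : 0 ≤ r • b := smul_nonneg hr0.le hb
    have hone : (0 : B) ≤ 1 := zero_le_one
    have he0 : 0 ≤ e := add_nonneg (smul_nonneg (by norm_num) hone) hrb0
    have he1 : 0 ≤ 1 - e := by
      have h4 : 1 - e = ((1 / 3 : ℝ) • (1 : B) - r • b) + (1 / 3 : ℝ) • (1 : B) := by
        rw [he]; module
      rw [h4]
      exact add_nonneg (sub_nonneg.2 hrb) (smul_nonneg (by norm_num) hone)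
    obtain ⟨c, hc⟩ := CStarAlgebra.nonneg_iff_eq_star_mul_self.1 he0
    obtain ⟨c', hc'⟩ := CStarAlgebra.nonneg_iff_eq_star_mul_self.1 he1
    have hjpos : ∀ x : B, 0 ≤ x → 0 ≤ F (j x) := by
      intro x hx
      obtain ⟨y, rfl⟩ := CStarAlgebra.nonneg_iff_eq_star_mul_self.1 hx
      rw [map_mul, map_star]
      exact F.map_nonneg (star_mul_self_nonneg _)
    have hsm : ∀ (s : ℝ) (x : B), F (j (s • x)) = s * F (j x) := fun s x => by
      rw [← Complex.coe_smul, map_smul, map_smul, smul_eq_mul]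
    have h5 : F (j (r • b)) ≤ ((1 / 3 : ℝ) : ℂ) := by
      have := hjpos _ (sub_nonneg.2 hrb)
      rw [map_sub, map_sub, hsm _ 1, map_one, hF1, mul_one] at this
      exact sub_nonneg.1 this
    have h6 := hjpos _ hrb0
    rw [Complex.nonneg_iff] at h6
    have hFe : F (j e) = ((1 / 3 + (F (j (r • b))).re : ℝ) : ℂ) := by
      rw [he, map_add, map_add, hsm _ 1, map_one, hF1, mul_one]
      apply Complex.ext
      · simp
      · simpa using h6.2.symm
    have h7 : (F (j (r • b))).re ≤ 1 / 3 := by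
      have := (Complex.le_def.1 h5).1
      simpa using this
    have hje : j e = star (j c) * j c := by rw [hc, map_mul, map_star]
    have hje' : star (j c') * j c' = 1 - j e := by
      rw [← map_star, ← map_mul, ← hc', map_sub, map_one]
    have key := apply_mul_of_mem_extremePoints i F hF1 hf (j c) (j c') (fun a => hij a c)
      (fun a => hij a c') (by rw [hje', hje]; abel) (p := 1 / 3 + (F (j (r • b))).re)
      (by linarith [h6.1]) (by linarith) (by rw [← hje, hFe]) a
    rw [← hje, he, map_add, map_add, mul_add, map_add, mul_add] at key
    have h8 : j ((1 / 3 : ℝ) • (1 : B)) = ((1 / 3 : ℝ) : ℂ) • 1 := by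
      rw [← Complex.coe_smul, map_smul, map_one]
    have h9 : j (r • b) = (r : ℂ) • j b := by rw [← Complex.coe_smul, map_smul]
    rw [h8, h9, mul_smul_comm, mul_smul_comm, map_smul, map_smul, map_smul, map_smul, mul_one,
      hF1] at key
    simp only [smul_eq_mul, mul_one] at key
    have hr0' : (r : ℂ) ≠ 0 := by exact_mod_cast hr0.ne'
    apply mul_left_cancel₀ hr0'
    linear_combination key
  obtain ⟨y, hy, -, hyx⟩ := CStarAlgebra.exists_sum_four_nonneg b
  rw [hyx]
  simp only [map_sum, map_smul, Finset.mul_sum, mul_smul_comm, smul_eq_mul]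
  refine Finset.sum_congr rfl fun k _ => ?_
  rw [hpos _ (hy k)]
  ring

end ProductState

section Slice

open scoped ComplexOrder InnerProductSpace

variable {A B T : Type*} [CStarAlgebra A] [CStarAlgebra B] [CStarAlgebra T]
  [PartialOrder B] [StarOrderedRing B]
  [PartialOrder T] [StarOrderedRing T]

/-- The algebraic slice map `a ⊗ b ↦ g a • b`. -/
def algSlice (g : A →ₗ[ℂ] ℂ) : A ⊗[ℂ] B →ₗ[ℂ] B :=
  TensorProduct.lift ((LinearMap.lsmul ℂ B).comp g)

@[simp] theorem algSlice_tmul {A B : Type*} [CStarAlgebra A] [CStarAlgebra B] (g : A →ₗ[ℂ] ℂ) (a : A) (b : B) :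
    algSlice g (a ⊗ₜ[ℂ] b) = g a • b := by
  simp [algSlice]

theorem norm_algSlice_le (h : CStarTensor A B T) (h1 : h.tmul 1 1 = 1) (F : T →ₚ[ℂ] ℂ)
    (g : A →ₗ[ℂ] ℂ) (η : B →ₚ[ℂ] ℂ) (hη : ∀ b, η b = F (h.tmul 1 b))
    (hF : ∀ a b, F (h.tmul a b) = g a * η b)
    (hinj : Function.Injective η.gnsStarAlgHom) (y : A ⊗[ℂ] B) :
    ‖algSlice g y‖ ≤ ‖h.ofAlg h1 y‖ := by
  have key : ∀ p q : B, η (star p * algSlice g y * q)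
      = F (star (h.tmul 1 p) * h.ofAlg h1 y * h.tmul 1 q) := by
    intro p q
    rw [h.star_tmul, star_one]
    induction y with
    | zero => simp
    | tmul a b =>
      simp [h.mul_tmul, hF]
    | add x y hx hy => simp only [map_add, mul_add, add_mul, hx, hy]
  have hnorm : ∀ p : B, ‖F.toPreGNS (h.tmul 1 p)‖ = ‖η.toPreGNS p‖ := by
    intro p
    rw [PositiveLinearMap.preGNS_norm_def, PositiveLinearMap.preGNS_norm_def]
    simp only [PositiveLinearMap.ofPreGNS_toPreGNS, hη]
    rw [h.star_tmul, h.mul_tmul, star_one, one_mul]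
  let _ : CStarAlgebra (η.GNS →L[ℂ] η.GNS) := {}
  let _ : CStarAlgebra (F.GNS →L[ℂ] F.GNS) := {}
  rw [← NonUnitalStarAlgHom.norm_map η.gnsStarAlgHom hinj]
  refine ContinuousLinearMap.opNorm_le_bound _ (norm_nonneg _) fun ξ => ?_
  induction ξ using UniformSpace.Completion.induction_on with
  | hp => exact isClosed_le (by fun_prop) (by fun_prop)
  | ih ξ =>
    set Z := algSlice g y with hZ
    set Y := h.ofAlg h1 y with hY
    obtain ⟨q, rfl⟩ := η.toPreGNS.surjective ξ
    have e1 : η.gnsStarAlgHom Z (η.toPreGNS q : η.GNS) = (η.toPreGNS (Z * q) : η.GNS) := by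
      change η.gnsNonUnitalStarAlgHom Z (η.toPreGNS q : η.GNS) = _
      rw [PositiveLinearMap.gnsNonUnitalStarAlgHom_apply_coe]
      rfl
    have e2 : F.gnsStarAlgHom Y (F.toPreGNS (h.tmul 1 q) : F.GNS)
        = (F.toPreGNS (Y * h.tmul 1 q) : F.GNS) := by
      change F.gnsNonUnitalStarAlgHom Y (F.toPreGNS (h.tmul 1 q) : F.GNS) = _
      rw [PositiveLinearMap.gnsNonUnitalStarAlgHom_apply_coe]
      rfl
    rw [e1, UniformSpace.Completion.norm_coe, UniformSpace.Completion.norm_coe]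
    have b1 : ‖F.toPreGNS (Y * h.tmul 1 q)‖ ≤ ‖Y‖ * ‖η.toPreGNS q‖ := by
      rw [← hnorm q, ← UniformSpace.Completion.norm_coe, ← e2,
        ← UniformSpace.Completion.norm_coe (F.toPreGNS (h.tmul 1 q))]
      refine (ContinuousLinearMap.le_opNorm _ _).trans ?_
      gcongr
      exact NonUnitalStarAlgHom.norm_apply_le F.gnsStarAlgHom Y
    have b2 : ‖η.toPreGNS (Z * q)‖ ^ 2
        ≤ ‖η.toPreGNS (Z * q)‖ * (‖Y‖ * ‖η.toPreGNS q‖) := by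
      have i1 : ⟪F.toPreGNS (h.tmul 1 (Z * q)), F.toPreGNS (Y * h.tmul 1 q)⟫_ℂ
          = ((‖η.toPreGNS (Z * q)‖ ^ 2 : ℝ) : ℂ) := by
        push_cast
        rw [PositiveLinearMap.preGNS_norm_sq, PositiveLinearMap.preGNS_inner_def]
        simp only [PositiveLinearMap.ofPreGNS_toPreGNS]
        rw [← mul_assoc, ← key, mul_assoc]
      have i2 := norm_inner_le_norm (𝕜 := ℂ) (F.toPreGNS (h.tmul 1 (Z * q)))
        (F.toPreGNS (Y * h.tmul 1 q))
      rw [i1, Complex.norm_real, Real.norm_of_nonneg (by positivity), hnorm] at i2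
      refine i2.trans ?_
      gcongr
    rcases (norm_nonneg (η.toPreGNS (Z * q))).eq_or_lt with h0 | h0
    · rw [← h0]; positivity
    · rw [sq] at b2
      exact le_of_mul_le_mul_left b2 h0

/-- In a tensor product of a nontrivial algebra having approximately inner half flip with
itself, there is a slice map associated with some state. -/
theorem exists_slice {D T : Type*} [CStarAlgebra D] [CStarAlgebra T] [PartialOrder D]
    [StarOrderedRing D] [Nontrivial D] (h : CStarTensor D D T) (h1 : h.tmul 1 1 = 1)
    (hff : FiniteApproxUnitaryEquiv (h.fstHom h1) (h.sndHom h1)) :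
    ∃ (g : D →ₚ[ℂ] ℂ) (E : T →L[ℂ] D), g 1 = 1 ∧ ∀ a b, E (h.tmul a b) = g a • b := by
  let _ := CStarAlgebra.spectralOrder T
  have _ := CStarAlgebra.spectralOrderedRing T
  have hT : Nontrivial T := by
    refine ⟨⟨1, 0, fun h0 => ?_⟩⟩
    have := h.norm_tmul 1 1
    rw [h1, h0] at this
    simp at this
  obtain ⟨F, hF1, hF⟩ := exists_product_state (h.fstHom h1) (h.sndHom h1) fun a b => by
    simp [Commute, SemiconjBy, h.mul_tmul]
  let g : D →ₚ[ℂ] ℂ := F.comp (PositiveLinearMap.ofClass (R := ℂ) (h.fstHom h1))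
  let η : D →ₚ[ℂ] ℂ := F.comp (PositiveLinearMap.ofClass (R := ℂ) (h.sndHom h1))
  have hη : ∀ b, η b = F (h.tmul 1 b) := fun b => rfl
  have hg : ∀ a, g a = F (h.tmul a 1) := fun b => rfl
  have hgη : ∀ a b, F (h.tmul a b) = g.toLinearMap a * η b := fun a b => by
    have := hF a b
    simp only [CStarTensor.fstHom_apply, CStarTensor.sndHom_apply, h.mul_tmul, mul_one,
      one_mul] at this
    exact this
  have hinj : Function.Injective η.gnsStarAlgHom := by
    have hne : (η.toPreGNS 1 : η.GNS) ≠ 0 := by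
      rw [← norm_ne_zero_iff, UniformSpace.Completion.norm_coe,
        PositiveLinearMap.preGNS_norm_def]
      simp [hη, h1, hF1]
    have : Nontrivial η.GNS := ⟨⟨_, _, hne⟩⟩
    let _ : CStarAlgebra (η.GNS →L[ℂ] η.GNS) := {}
    exact injective_of_halfFlip h h1 hff η.gnsStarAlgHom
  have hbound : ∀ y, ‖algSlice (B := D) g.toLinearMap y‖ ≤ 1 * ‖(h.ofAlg h1).toLinearMap y‖ :=
    fun y => by
      rw [one_mul]
      exact norm_algSlice_le h h1 F g.toLinearMap η hη hgη hinj y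
  refine ⟨g, (algSlice g.toLinearMap).extendOfNorm (h.ofAlg h1).toLinearMap, ?_, fun a b => ?_⟩
  · rw [hg, h1, hF1]
  · have := LinearMap.extendOfNorm_eq (f := algSlice (B := D) g.toLinearMap)
      (e := (h.ofAlg h1).toLinearMap) (h.denseRange_ofAlg h1) ⟨1, hbound⟩ (a ⊗ₜ b)
    simpa using this

end Slice

section Universal

open scoped ComplexOrder InnerProductSpace

theorem PositiveLinearMap.sum_gram_nonneg {D C K : Type*} [CStarAlgebra D] [PartialOrder D]
    [StarOrderedRing D] [CStarAlgebra C] [PartialOrder C] [StarOrderedRing C] [Fintype K]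
    (g : D →ₚ[ℂ] ℂ) (p : K → D) (X : K → C) :
    0 ≤ ∑ r, ∑ s, g (star (p r) * p s) • (star (X r) * X s) := by
  classical
  obtain ⟨m, v, hv⟩ := Matrix.posSemidef_iff_eq_sum_vecMulVec.1
    (Matrix.posSemidef_gram ℂ fun r => g.toPreGNS (p r))
  have hg : ∀ r s, g (star (p r) * p s) = ∑ i, v i r * star (v i s) := by
    intro r s
    have := congrFun (congrFun hv r) s
    rw [Matrix.sum_apply] at this
    simpa [Matrix.gram, PositiveLinearMap.preGNS_inner_def, Matrix.vecMulVec_apply] using this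
  have : ∑ r, ∑ s, g (star (p r) * p s) • (star (X r) * X s)
      = ∑ i, star (∑ s, star (v i s) • X s) * ∑ s, star (v i s) • X s := by
    simp only [hg, star_sum, Finset.sum_mul, Finset.mul_sum, Finset.sum_smul, star_smul,
      star_star, smul_mul_smul_comm]
    rw [Finset.sum_comm_cycle]
    refine Finset.sum_congr rfl fun i _ => Finset.sum_comm
  rw [this]
  exact Finset.sum_nonneg fun i _ => star_mul_self_nonneg _

variable {D T C : Type*} [CStarAlgebra D] [CStarAlgebra T] [CStarAlgebra C]
  [PartialOrder D] [StarOrderedRing D] [PartialOrder T] [StarOrderedRing T]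
  [PartialOrder C] [StarOrderedRing C]

theorem CStarTensor.ofAlg_sum {D T : Type*} [CStarAlgebra D] [CStarAlgebra T]
    (h : CStarTensor D D T) (h1 : h.tmul 1 1 = 1) {x : D ⊗[ℂ] D}
    {S : Finset (D × D)} (hx : x = ∑ i ∈ S, i.1 ⊗ₜ[ℂ] i.2) :
    h.ofAlg h1 x = ∑ i ∈ S, h.tmul i.1 i.2 := by
  simp [hx]

/-- Compressing a slice map by an algebraic tensor gives a positive map on the tensor product. -/
theorem exists_positive_compression (h : CStarTensor D D T) (h1 : h.tmul 1 1 = 1)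
    (g : D →ₚ[ℂ] ℂ) (E : T →L[ℂ] D) (hE : ∀ a b, E (h.tmul a b) = g a • b)
    (γ₁ γ₂ : D →⋆ₐ[ℂ] C) (hγ : ∀ a b, Commute (γ₁ a) (γ₂ b)) (x : D ⊗[ℂ] D) :
    ∃ P : T →ₚ[ℂ] C, ∀ d c, P (h.tmul d c) =
      γ₁ (E (star (h.ofAlg h1 x) * h.tmul d 1 * h.ofAlg h1 x)) * γ₂ c := by
  classical
  obtain ⟨S, hS⟩ := TensorProduct.exists_finset x
  have hγ₂ : Continuous γ₂ := (StarAlgHom.lipschitz γ₂).continuous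
  let P₀ : T →ₗ[ℂ] C :=
    { toFun := fun t => ∑ i ∈ S, ∑ j ∈ S,
        star (γ₁ i.2) * γ₂ (E (star (h.tmul i.1 1) * t * h.tmul j.1 1)) * γ₁ j.2
      map_add' := fun s t => by simp [mul_add, add_mul, Finset.sum_add_distrib]
      map_smul' := fun c t => by simp [Finset.smul_sum] }
  have hP₀ : ∀ t, P₀ t = ∑ i ∈ S, ∑ j ∈ S,
      star (γ₁ i.2) * γ₂ (E (star (h.tmul i.1 1) * t * h.tmul j.1 1)) * γ₁ j.2 := fun t => rfl
  have hP₀c : Continuous P₀ := by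
    change Continuous fun t => ∑ i ∈ S, ∑ j ∈ S,
      star (γ₁ i.2) * γ₂ (E (star (h.tmul i.1 1) * t * h.tmul j.1 1)) * γ₁ j.2
    fun_prop
  have hpos : ∀ t : T, 0 ≤ P₀ (star t * t) := by
    intro t
    refine (h.denseRange_ofAlg h1).induction_on (p := fun t => 0 ≤ P₀ (star t * t)) t ?_ ?_
    · exact isClosed_le continuous_const (hP₀c.comp (by fun_prop))
    · intro y
      obtain ⟨R, hR⟩ := TensorProduct.exists_finset y
      have := g.sum_gram_nonneg (K := S × R) (fun r => r.2.1.1 * r.1.1.1)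
        (fun r => γ₂ r.2.1.2 * γ₁ r.1.1.2)
      convert this using 1
      rw [hP₀, h.ofAlg_sum h1 hR, Fintype.sum_prod_type, ← Finset.sum_coe_sort S]
      simp only [Fintype.sum_prod_type]
      refine Finset.sum_congr rfl fun i _ => ?_
      rw [← Finset.sum_coe_sort S, Finset.sum_comm]
      refine Finset.sum_congr rfl fun j _ => ?_
      rw [← Finset.sum_coe_sort R]
      simp only [star_sum, Finset.sum_mul, Finset.mul_sum, map_sum]
      rw [Finset.sum_comm]
      refine Finset.sum_congr rfl fun k _ => ?_
      refine Finset.sum_congr rfl fun l _ => ?_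
      simp only [h.star_tmul, h.mul_tmul, hE, map_smul, star_mul, star_one, one_mul, mul_one,
        mul_smul_comm, smul_mul_assoc, map_mul, map_star, mul_assoc]
  refine ⟨PositiveLinearMap.mk₀ P₀ fun t ht => ?_, fun d c => ?_⟩
  · obtain ⟨s, rfl⟩ := CStarAlgebra.nonneg_iff_eq_star_mul_self.1 ht
    exact hpos s
  · change P₀ _ = _
    rw [hP₀, h.ofAlg_sum h1 hS]
    simp only [star_sum, Finset.sum_mul, Finset.mul_sum, map_sum]
    rw [Finset.sum_comm]
    refine Finset.sum_congr rfl fun i _ => ?_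
    refine Finset.sum_congr rfl fun j _ => ?_
    simp only [h.star_tmul, h.mul_tmul, hE, map_smul, star_one, one_mul, mul_one,
      mul_smul_comm, smul_mul_assoc, map_mul, map_star, mul_assoc]
    rw [(hγ _ c).eq]

/-- The unitaries implementing the half flip can be replaced by algebraic tensors. -/
theorem exists_algebraic_halfFlip {D T : Type*} [CStarAlgebra D] [CStarAlgebra T]
    [TopologicalSpace.SeparableSpace D]
    (h : CStarTensor D D T) (h1 : h.tmul 1 1 = 1)
    (hff : FiniteApproxUnitaryEquiv (h.fstHom h1) (h.sndHom h1)) :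
    ∃ x : ℕ → D ⊗[ℂ] D, ∀ d, Tendsto
      (fun n => star (h.ofAlg h1 (x n)) * h.tmul d 1 * h.ofAlg h1 (x n)) atTop
      (𝓝 (h.tmul 1 d)) := by
  obtain ⟨u, hu, hlim⟩ := hff.exists_seq (StarAlgHom.lipschitz _) (StarAlgHom.lipschitz _)
  have := fun n : ℕ => (h.denseRange_ofAlg h1).exists_dist_lt (u n)
    (show (0 : ℝ) < 1 / (n + 1) by positivity)
  choose x hx using this
  refine ⟨x, fun d => ?_⟩
  set m := h.tmul d 1 with hm
  have hδ : Tendsto (fun n => h.ofAlg h1 (x n) - u n) atTop (𝓝 0) := by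
    rw [tendsto_zero_iff_norm_tendsto_zero]
    refine squeeze_zero (fun _ => norm_nonneg _) (fun n => ?_)
      tendsto_one_div_add_atTop_nhds_zero_nat
    rw [norm_sub_rev, ← dist_eq_norm]
    exact (hx n).le
  have hub : ∀ n, ‖u n‖ ≤ 1 := fun n => by
    nontriviality T
    exact (CStarRing.norm_of_mem_unitary (hu n)).le
  have t1 : Tendsto (fun n => star (u n) * m * (h.ofAlg h1 (x n) - u n)) atTop (𝓝 0) := by
    rw [tendsto_zero_iff_norm_tendsto_zero] at hδ ⊢
    refine squeeze_zero (fun _ => norm_nonneg _) (fun n => ?_)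
      (by simpa using hδ.const_mul ‖m‖)
    calc _ ≤ ‖star (u n)‖ * ‖m‖ * ‖h.ofAlg h1 (x n) - u n‖ := norm_mul₃_le
      _ ≤ 1 * ‖m‖ * ‖h.ofAlg h1 (x n) - u n‖ := by
        gcongr
        rw [norm_star]; exact hub n
      _ = _ := by rw [one_mul]
  have t2 : Tendsto (fun n => star (h.ofAlg h1 (x n) - u n) * m * u n) atTop (𝓝 0) := by
    rw [tendsto_zero_iff_norm_tendsto_zero] at hδ ⊢
    refine squeeze_zero (fun _ => norm_nonneg _) (fun n => ?_)
      (by simpa using hδ.mul_const ‖m‖)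
    calc _ ≤ ‖star (h.ofAlg h1 (x n) - u n)‖ * ‖m‖ * ‖u n‖ := norm_mul₃_le
      _ ≤ ‖h.ofAlg h1 (x n) - u n‖ * ‖m‖ * 1 := by
        rw [norm_star]
        gcongr
        exact hub n
      _ = _ := by rw [mul_one]
  have t3 : Tendsto (fun n => star (h.ofAlg h1 (x n) - u n) * m * (h.ofAlg h1 (x n) - u n))
      atTop (𝓝 0) := by
    have := (hδ.star.mul_const m).mul hδ
    simpa using this
  have := ((hlim d).add t1).add (t2.add t3)
  simp only [add_zero, CStarTensor.sndHom_apply, CStarTensor.fstHom_apply] at this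
  refine this.congr fun n => ?_
  rw [star_sub]
  noncomm_ring

/-- A separable algebra having approximately inner half flip is nuclear to the extent that
any pair of commuting representations factors through the given tensor product. -/
theorem exists_starAlgHom_of_commute {D T C : Type*} [CStarAlgebra D] [CStarAlgebra T]
    [CStarAlgebra C] [TopologicalSpace.SeparableSpace D] [Nontrivial D]
    (h : CStarTensor D D T) (h1 : h.tmul 1 1 = 1)
    (hff : FiniteApproxUnitaryEquiv (h.fstHom h1) (h.sndHom h1))
    (γ₁ γ₂ : D →⋆ₐ[ℂ] C) (hγ : ∀ a b, Commute (γ₁ a) (γ₂ b)) :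
    ∃ Φ : T →⋆ₐ[ℂ] C, ∀ a b, Φ (h.tmul a b) = γ₁ a * γ₂ b := by
  let _ := CStarAlgebra.spectralOrder D
  have _ := CStarAlgebra.spectralOrderedRing D
  let _ := CStarAlgebra.spectralOrder T
  have _ := CStarAlgebra.spectralOrderedRing T
  let _ := CStarAlgebra.spectralOrder C
  have _ := CStarAlgebra.spectralOrderedRing C
  obtain ⟨g, E, hg1, hE⟩ := exists_slice h h1 hff
  obtain ⟨x, hx⟩ := exists_algebraic_halfFlip h h1 hff
  choose P hP using fun n => exists_positive_compression h h1 g E hE γ₁ γ₂ hγ (x n)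
  let Φ₀ : D ⊗[ℂ] D →ₐ[ℂ] C :=
    Algebra.TensorProduct.lift (γ₁ : D →ₐ[ℂ] C) (γ₂ : D →ₐ[ℂ] C) hγ
  have hΦ₀ : ∀ a b, Φ₀ (a ⊗ₜ b) = γ₁ a * γ₂ b := fun a b => by simp [Φ₀]
  have hΦ₀s : ∀ y, Φ₀ (star y) = star (Φ₀ y) := by
    intro y
    induction y with
    | zero => simp
    | tmul a b =>
      rw [TensorProduct.star_tmul, hΦ₀, hΦ₀, star_mul, ← map_star, ← map_star, (hγ _ _).eq]
    | add x y hx hy => simp [hx, hy]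
  have hlim : ∀ z, Tendsto (fun n => P n (h.ofAlg h1 z)) atTop (𝓝 (Φ₀ z)) := by
    intro z
    induction z with
    | zero => simp
    | tmul a b =>
      rw [hΦ₀]
      simp only [CStarTensor.ofAlg_tmul, hP]
      have hγ₁ : Continuous γ₁ := (StarAlgHom.lipschitz γ₁).continuous
      have := ((hγ₁.comp E.continuous).tendsto _).comp (hx a)
      simp only [Function.comp_def, hE, hg1, one_smul] at this
      exact this.mul_const _
    | add y z hy hz => simpa using hy.add hz
  have hone : ‖(1 : C)‖ ≤ 1 := by
    nontriviality C
    simp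
  have hpos : ∀ z, 0 ≤ h.ofAlg h1 z → ‖Φ₀ z‖ ≤ ‖h.ofAlg h1 z‖ := by
    intro z hz
    have l1 := (hlim 1).norm.mul_const ‖h.ofAlg h1 z‖
    rw [map_one, map_one] at l1
    have := le_of_tendsto_of_tendsto' (hlim z).norm l1 fun n =>
      (P n).norm_apply_le_of_nonneg _ hz
    nlinarith [norm_nonneg (h.ofAlg h1 z)]
  have hbound : ∀ y, ‖Φ₀.toLinearMap y‖ ≤ 1 * ‖(h.ofAlg h1).toLinearMap y‖ := by
    intro y
    simp only [AlgHom.toLinearMap_apply, one_mul]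
    have hy : h.ofAlg h1 (star y * y) = star (h.ofAlg h1 y) * h.ofAlg h1 y := by
      rw [map_mul, h.ofAlg_star]
    have := hpos (star y * y) (by rw [hy]; exact star_mul_self_nonneg _)
    rw [hy, map_mul, hΦ₀s, CStarRing.norm_star_mul_self, CStarRing.norm_star_mul_self,
      ← sq, ← sq] at this
    exact le_of_sq_le_sq this (norm_nonneg _)
  have hdense : DenseRange (h.ofAlg h1).toLinearMap := h.denseRange_ofAlg h1
  let Φ := Φ₀.toLinearMap.extendOfNorm (h.ofAlg h1).toLinearMap
  have hΦ : ∀ y, Φ (h.ofAlg h1 y) = Φ₀ y := fun y =>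
    LinearMap.extendOfNorm_eq hdense ⟨1, hbound⟩ y
  have hΦ1 : Φ 1 = 1 := by simpa using hΦ 1
  refine ⟨{ toFun := Φ
            map_one' := hΦ1
            map_mul' := ?_
            map_zero' := map_zero Φ
            map_add' := map_add Φ
            commutes' := ?_
            map_star' := ?_ }, fun a b => ?_⟩
  · refine fun s t => (h.denseRange_ofAlg h1).induction_on₂
      (p := fun s t => Φ (s * t) = Φ s * Φ t) (isClosed_eq (by fun_prop) (by fun_prop))
      (fun y z => ?_) s t
    rw [← map_mul, hΦ, hΦ, hΦ, map_mul]
  · intro r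
    simp [Algebra.algebraMap_eq_smul_one, hΦ1]
  · refine fun s => (h.denseRange_ofAlg h1).induction_on
      (p := fun s => Φ (star s) = star (Φ s)) s (isClosed_eq (by fun_prop) (by fun_prop))
      (fun y => ?_)
    rw [← h.ofAlg_star, hΦ, hΦ, hΦ₀s]
  · change Φ _ = _
    rw [← h.ofAlg_tmul h1, hΦ, hΦ₀]

end Universal

section Absorption

theorem FiniteApproxUnitaryEquiv.approxUnitaryEquiv {B C : Type*} [CStarAlgebra B]
    [CStarAlgebra C] [TopologicalSpace.SeparableSpace B] {φ ψ : B →⋆ₐ[ℂ] C}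
    (h : FiniteApproxUnitaryEquiv φ ψ) : ApproxUnitaryEquiv φ ψ :=
  (approxUnitaryEquiv_iff _ _).2 (h.exists_seq (StarAlgHom.lipschitz _) (StarAlgHom.lipschitz _))

theorem approxUnitaryEquiv_of_subsingleton {X B : Type*} [CStarAlgebra B] [Subsingleton B]
    (φ ψ : X → B) : ApproxUnitaryEquiv φ ψ :=
  (approxUnitaryEquiv_iff _ _).2 ⟨fun _ => 1, fun _ => one_mem _, fun a => by
    rw [Subsingleton.elim (ψ a) (star 1 * φ a * 1)]
    exact tendsto_const_nhds⟩

/-- If the identity of `C` is approximately unitarily equivalent to an endomorphism whose range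
commutes with that of `γ`, then every unital `*`-homomorphism `D → C` is equivalent to `γ`. -/
theorem finiteApproxUnitaryEquiv_of_commute {D T C : Type*} [CStarAlgebra D] [CStarAlgebra T]
    [CStarAlgebra C] [TopologicalSpace.SeparableSpace D] [Nontrivial D]
    (h : CStarTensor D D T) (h1 : h.tmul 1 1 = 1)
    (hff : FiniteApproxUnitaryEquiv (h.fstHom h1) (h.sndHom h1))
    (j : C →⋆ₐ[ℂ] C) (hj : FiniteApproxUnitaryEquiv id j) (γ : D →⋆ₐ[ℂ] C)
    (hcomm : ∀ c d, Commute (j c) (γ d)) (α : D →⋆ₐ[ℂ] C) :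
    FiniteApproxUnitaryEquiv α γ := by
  obtain ⟨Φ, hΦ⟩ := exists_starAlgHom_of_commute h h1 hff (j.comp α) γ
    fun a b => hcomm (α a) b
  have e1 : FiniteApproxUnitaryEquiv α (j ∘ α) := hj.comp_right α
  have e2 := hff.comp_left Φ
  have e3 : Φ ∘ h.fstHom h1 = j ∘ α := by
    ext d
    simp [hΦ]
  have e4 : Φ ∘ h.sndHom h1 = γ := by
    ext d
    simp [hΦ]
  rw [e3, e4] at e2
  exact e1.trans e2

theorem isClosed_setOf_cauchySeq_conj {C : Type*} [CStarAlgebra C] {u : ℕ → C}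
    (hu : ∀ n, u n ∈ unitary C) :
    IsClosed {c | CauchySeq fun n => star (u n) * c * u n} := by
  refine isClosed_of_closure_subset fun c hc => ?_
  refine Metric.cauchySeq_iff.2 fun ε hε => ?_
  obtain ⟨b, hb, hcb⟩ := Metric.mem_closure_iff.1 hc (ε / 3) (by positivity)
  obtain ⟨N, hN⟩ := Metric.cauchySeq_iff.1 hb (ε / 3) (by positivity)
  have key : ∀ n, dist (star (u n) * c * u n) (star (u n) * b * u n) = dist c b := fun n => by
    rw [dist_eq_norm, dist_eq_norm, ← sub_mul, ← mul_sub, norm_unitary_conj (hu n)]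
  refine ⟨N, fun m hm n hn => ?_⟩
  have h1 := dist_triangle4 (star (u m) * c * u m) (star (u m) * b * u m)
    (star (u n) * b * u n) (star (u n) * c * u n)
  rw [key, dist_comm (star (u n) * b * u n), key] at h1
  linarith [hN m hm n hn]

/-- A pointwise limit of inner automorphisms is a unital `*`-homomorphism. -/
theorem exists_starAlgHom_of_tendsto_conj {C : Type*} [CStarAlgebra C] {u : ℕ → C}
    (hu : ∀ n, u n ∈ unitary C) {j : C → C}
    (hj : ∀ c, Tendsto (fun n => star (u n) * c * u n) atTop (𝓝 (j c))) :
    ∃ J : C →⋆ₐ[ℂ] C, (J : C → C) = j := by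
  have huu : ∀ n, star (u n) * u n = 1 := fun n => Unitary.star_mul_self_of_mem (hu n)
  have huu' : ∀ n, u n * star (u n) = 1 := fun n => Unitary.mul_star_self_of_mem (hu n)
  have hscalar : ∀ r : ℂ, j (algebraMap ℂ C r) = algebraMap ℂ C r := fun r => by
    refine tendsto_nhds_unique (hj _) (tendsto_const_nhds.congr fun n => ?_)
    rw [← Algebra.commutes, mul_assoc, huu, mul_one]
  have hadd : ∀ a b, j (a + b) = j a + j b := fun a b => by
    refine tendsto_nhds_unique (hj _) (((hj a).add (hj b)).congr fun n => ?_)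
    rw [mul_add, add_mul]
  have hmul : ∀ a b, j (a * b) = j a * j b := fun a b => by
    refine tendsto_nhds_unique (hj _) (((hj a).mul (hj b)).congr fun n => ?_)
    calc star (u n) * a * u n * (star (u n) * b * u n)
        = star (u n) * a * (u n * star (u n)) * b * u n := by noncomm_ring
      _ = star (u n) * (a * b) * u n := by rw [huu']; noncomm_ring
  have hstar : ∀ a, j (star a) = star (j a) := fun a => by
    refine tendsto_nhds_unique (hj _) ((hj a).star.congr fun n => ?_)
    simp [mul_assoc]
  exact ⟨{ toFun := j
           map_one' := by simpa using hscalar 1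
           map_mul' := hmul
           map_zero' := by simpa using hscalar 0
           map_add' := hadd
           commutes' := hscalar
           map_star' := hstar }, rfl⟩

/-- An approximately inner endomorphism of the second leg extends to the tensor product. -/
theorem exists_id_tensor {A D C : Type*} [CStarAlgebra A] [CStarAlgebra D] [CStarAlgebra C]
    (h : CStarTensor A D C) (h1 : h.tmul 1 1 = 1) [TopologicalSpace.SeparableSpace D]
    (ψ : D →⋆ₐ[ℂ] D) (hψ : FiniteApproxUnitaryEquiv id ψ) :
    ∃ J : C →⋆ₐ[ℂ] C, (∀ a d, J (h.tmul a d) = h.tmul a (ψ d)) ∧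
      FiniteApproxUnitaryEquiv id J := by
  obtain ⟨w, hw, hlim⟩ := hψ.exists_seq LipschitzWith.id (StarAlgHom.lipschitz _)
  set u : ℕ → C := fun n => h.sndHom h1 (w n) with hu_def
  have hu : ∀ n, u n ∈ unitary C := fun n => Unitary.map_mem (h.sndHom h1) (hw n)
  have htmul : ∀ a d, Tendsto (fun n => star (u n) * h.tmul a d * u n) atTop
      (𝓝 (h.tmul a (ψ d))) := by
    intro a d
    have hs : Continuous (h.sndHom h1) := (StarAlgHom.lipschitz _).continuous
    have := (((hs.tendsto _).comp (hlim d)).const_mul (h.tmul a 1))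
    simp only [Function.comp_def, CStarTensor.sndHom_apply, h.mul_tmul, mul_one, one_mul,
      id_eq] at this
    refine this.congr fun n => ?_
    simp [hu_def, h.star_tmul, h.mul_tmul]
  have hcauchy : ∀ c, CauchySeq fun n => star (u n) * c * u n := by
    refine h.induction_closed (isClosed_setOf_cauchySeq_conj hu)
      (fun a d => (htmul a d).cauchySeq) ?_ ?_ ?_
    · simpa using (tendsto_const_nhds (x := (0 : C)) (f := atTop (α := ℕ))).cauchySeq
    · intro s t hs ht
      obtain ⟨x, hx⟩ := cauchySeq_tendsto_of_complete hs
      obtain ⟨y, hy⟩ := cauchySeq_tendsto_of_complete ht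
      have := (hx.add hy).cauchySeq
      simpa [mul_add, add_mul] using this
    · intro c t ht
      obtain ⟨x, hx⟩ := cauchySeq_tendsto_of_complete ht
      have := (hx.const_smul c).cauchySeq
      simpa using this
  choose j hj using fun c => cauchySeq_tendsto_of_complete (hcauchy c)
  obtain ⟨J, rfl⟩ := exists_starAlgHom_of_tendsto_conj hu hj
  exact ⟨J, fun a d => tendsto_nhds_unique (hj _) (htmul a d),
    ((approxUnitaryEquiv_iff _ _).2 ⟨u, hu, hj⟩).finite⟩

end Absorption
/-- If `D` is separable, unital and strongly self-absorbing and `A` is separable and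
unital, then any two unital *-homomorphisms `D → A ⊗ D` are approximately unitarily
equivalent; in particular any two unital endomorphisms of `D` are approximately
unitarily equivalent. -/
theorem stmt_7 {A : Type u} {D : Type u} {TD AD : Type u}
    [CStarAlgebra A] [CStarAlgebra D] [CStarAlgebra TD] [CStarAlgebra AD]
    [TopologicalSpace.SeparableSpace A] [TopologicalSpace.SeparableSpace D]
    (hD : MinTensor D D TD) (hDu : hD.tmul 1 1 = 1)
    (hssa : IsStronglySelfAbsorbing hD)
    (hAD : MinTensor A D AD) (hADu : hAD.tmul 1 1 = 1)
    (α β : D →⋆ₐ[ℂ] AD) :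
    ApproxUnitaryEquiv (⇑α) (⇑β) ∧
      ∀ f g : D →⋆ₐ[ℂ] D, ApproxUnitaryEquiv (⇑f) (⇑g) := by
  obtain ⟨-, φ, hφ⟩ := hssa
  rcases subsingleton_or_nontrivial D with hD0 | hD0
  · have hAD0 : Subsingleton AD := by
      refine subsingleton_of_zero_eq_one ?_
      rw [eq_comm, ← norm_eq_zero, ← hADu, hAD.norm_tmul, Subsingleton.elim (1 : D) 0]
      simp
    exact ⟨approxUnitaryEquiv_of_subsingleton _ _,
      fun f g => approxUnitaryEquiv_of_subsingleton _ _⟩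
  have hff : FiniteApproxUnitaryEquiv (hD.fstHom hDu) (hD.sndHom hDu) :=
    halfFlip_of_iso hD hDu φ hφ.finite
  let ψ₁ : D →⋆ₐ[ℂ] D := (φ.symm : TD →⋆ₐ[ℂ] D).comp (hD.fstHom hDu)
  let ψ₂ : D →⋆ₐ[ℂ] D := (φ.symm : TD →⋆ₐ[ℂ] D).comp (hD.sndHom hDu)
  have hψ : ∀ c d, Commute (ψ₁ c) (ψ₂ d) := by
    intro c d
    have : Commute (hD.fstHom hDu c) (hD.sndHom hDu d) := by
      simp [Commute, SemiconjBy, hD.mul_tmul]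
    exact this.map (φ.symm : TD →⋆ₐ[ℂ] D)
  have hψ₁ : FiniteApproxUnitaryEquiv id ψ₁ := by
    have := hφ.finite.comp_left (φ.symm : TD →⋆ₐ[ℂ] D)
    have e : (φ.symm : TD →⋆ₐ[ℂ] D) ∘ φ = id := by
      ext d
      simp
    rwa [e] at this
  obtain ⟨J, hJ, hJid⟩ := exists_id_tensor hAD.toCStarTensor hADu ψ₁ hψ₁
  have hJc : Continuous J := (StarAlgHom.lipschitz J).continuous
  have hcomm : ∀ c d, Commute (J c) ((hAD.sndHom hADu).comp ψ₂ d) := by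
    intro c d
    refine hAD.induction_closed (p := fun c => Commute (J c) ((hAD.sndHom hADu).comp ψ₂ d))
      (isClosed_eq (by fun_prop) (by fun_prop)) (fun a b => ?_) ?_ ?_ ?_ c
    · rw [hJ]
      simp [Commute, SemiconjBy, hAD.mul_tmul, (hψ b d).eq]
    · simp
    · intro s t hs ht
      rw [map_add]
      exact hs.add_left ht
    · intro k t ht
      rw [map_smul]
      exact ht.smul_left k
  have main := finiteApproxUnitaryEquiv_of_commute hD.toCStarTensor hDu hff J hJid
    ((hAD.sndHom hADu).comp ψ₂) hcomm
  have mainD := finiteApproxUnitaryEquiv_of_commute hD.toCStarTensor hDu hff ψ₁ hψ₁ ψ₂ hψ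
  exact ⟨((main α).trans (main β).symm).approxUnitaryEquiv,
    fun f g => ((mainD f).trans (mainD g).symm).approxUnitaryEquiv⟩
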